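/- arXiv:2602.21424 — 4 statements merged into one kernel-verified Lean document; each statement's English description precedes it below -/
import Mathlib

section
/- Let A be a finite type, let π₀, π₁ : A → ℝ be probability vectors, and let a₀, a₁ ∈ A with a₀ ≠ a₁. Let ε ≥ 0 satisfy ∑ a, |π₀ a − π₁ a| ≤ ε. Let Δ > 0 and V_max ∈ ℝ, and let J₀, J₁ ∈ ℝ satisfy J₀ ≤ V_max − Δ·(1 − π₀ a₀) and J₁ ≤ V_max − Δ·(1 − π₁ a₁). Then the infimum over priors p ∈ [0,1] of the mixed return p·J₀ + (1−p)·J₁ is at most V_max − (Δ/2)·(1 − ε). -/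
open Finset

theorem add_le_sum_of_ne {A : Type*} [Fintype A] {f : A → ℝ} (hf : ∀ a, 0 ≤ f a)
    {a b : A} (hab : a ≠ b) : f a + f b ≤ ∑ x, f x := by
  classical
  rw [← Finset.sum_pair hab]
  exact Finset.sum_le_univ_sum_of_nonneg hf

theorem bddBelow_mixtures (x y : ℝ) :
    BddBelow {z : ℝ | ∃ p ∈ Set.Icc (0 : ℝ) 1, z = p * x + (1 - p) * y} := by
  refine ⟨min x y, ?_⟩
  rintro _ ⟨p, ⟨hp₀, hp₁⟩, rfl⟩
  nlinarith [mul_le_mul_of_nonneg_left (min_le_left x y) hp₀,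
    mul_le_mul_of_nonneg_left (min_le_right x y) (sub_nonneg.2 hp₁)]

/-- Lemma 1 (Robustness Requires Epistemic Distance): if the behavioural
distance between the two mode-conditioned action distributions is at most ε,
then the infimum over latent priors of the mixed return is bounded above by
`V_max − (Δ/2)·(1 − ε)`. -/
theorem robustness_requires_epistemic_distance
    {A : Type*} [Fintype A]
    (π₀ π₁ : A → ℝ)
    (hπ₀_nonneg : ∀ a, 0 ≤ π₀ a) (hπ₀_sum : ∑ a, π₀ a = 1)
    (hπ₁_nonneg : ∀ a, 0 ≤ π₁ a) (hπ₁_sum : ∑ a, π₁ a = 1)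
    (a₀ a₁ : A) (hne : a₀ ≠ a₁)
    (ε : ℝ) (hε : 0 ≤ ε)
    (hdist : ∑ a, |π₀ a - π₁ a| ≤ ε)
    (Δ : ℝ) (hΔ : 0 < Δ) (Vmax : ℝ)
    (J₀ J₁ : ℝ)
    (hJ₀ : J₀ ≤ Vmax - Δ * (1 - π₀ a₀))
    (hJ₁ : J₁ ≤ Vmax - Δ * (1 - π₁ a₁)) :
    sInf {x : ℝ | ∃ p ∈ Set.Icc (0 : ℝ) 1, x = p * J₀ + (1 - p) * J₁}
      ≤ Vmax - Δ / 2 * (1 - ε) := by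
  have hpair : π₀ a₀ + π₀ a₁ ≤ 1 := hπ₀_sum ▸ add_le_sum_of_ne hπ₀_nonneg hne
  have hclose : |π₀ a₁ - π₁ a₁| ≤ ε :=
    (Finset.single_le_sum (f := fun a => |π₀ a - π₁ a|) (fun a _ => abs_nonneg _)
      (Finset.mem_univ a₁)).trans hdist
  have hmass : π₀ a₀ + π₁ a₁ ≤ 1 + ε := by linarith [(abs_le.1 hclose).1]
  refine (csInf_le (bddBelow_mixtures J₀ J₁) ⟨1 / 2, by norm_num, rfl⟩).trans ?_
  nlinarith [mul_le_mul_of_nonneg_left hmass hΔ.le]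
end

section
/- Let A be a finite type, let p, q : A → ℝ be probability vectors, let a₀, a₁ ∈ A with a₀ ≠ a₁, and let ε ≥ 0 satisfy ∑ a, |p a − q a| ≤ ε. Then min (p a₀) (q a₁) ≤ (1 + ε) / 2. -/
open Finset

/-- Central step of Lemma 1: under bounded behavioural distance ε, a policy
cannot allocate high probability to both mode-specific optimal actions:
`min (p a₀) (q a₁) ≤ (1 + ε) / 2`. -/
theorem min_mass_le_half_one_add_eps
    {A : Type*} [Fintype A]
    (p q : A → ℝ)
    (hp_nonneg : ∀ a, 0 ≤ p a) (hp_sum : ∑ a, p a = 1)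
    (hq_nonneg : ∀ a, 0 ≤ q a) (hq_sum : ∑ a, q a = 1)
    (a₀ a₁ : A) (hne : a₀ ≠ a₁)
    (ε : ℝ) (hε : 0 ≤ ε)
    (hdist : ∑ a, |p a - q a| ≤ ε) :
    min (p a₀) (q a₁) ≤ (1 + ε) / 2 := by
  have hp : p a₀ + p a₁ ≤ 1 :=
    hp_sum ▸ add_le_sum (fun a _ => hp_nonneg a) (mem_univ a₀) (mem_univ a₁) hne
  have hd : |p a₁ - q a₁| ≤ ε :=
    (single_le_sum (f := fun a => |p a - q a|) (fun a _ => abs_nonneg _) (mem_univ a₁)).trans hdist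
  linarith [min_le_left (p a₀) (q a₁), min_le_right (p a₀) (q a₁), neg_abs_le (p a₁ - q a₁)]
end

section
/- Let A be a finite type, let π₀, π₁ : A → ℝ be probability vectors with π₀ = π₁ (zero behavioural distance), and let a₀, a₁ ∈ A with a₀ ≠ a₁. Let Δ > 0 and V_max ∈ ℝ, and let J₀, J₁ ∈ ℝ satisfy J₀ ≤ V_max − Δ·(1 − π₀ a₀) and J₁ ≤ V_max − Δ·(1 − π₁ a₁). Then min J₀ J₁ ≤ V_max − Δ / 2. -/
open Finset

/-- Limiting case d(π) = 0 of Lemma 1: if the two probe-conditioned response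
distributions coincide, the worst-case mode return is at most `V_max − Δ/2`. -/
theorem zero_behavioural_distance_bound
    {A : Type*} [Fintype A]
    (π₀ π₁ : A → ℝ)
    (hπ₀_nonneg : ∀ a, 0 ≤ π₀ a) (hπ₀_sum : ∑ a, π₀ a = 1)
    (hπ₁_nonneg : ∀ a, 0 ≤ π₁ a) (hπ₁_sum : ∑ a, π₁ a = 1)
    (heq : π₀ = π₁)
    (a₀ a₁ : A) (hne : a₀ ≠ a₁)
    (Δ : ℝ) (hΔ : 0 < Δ) (Vmax : ℝ)
    (J₀ J₁ : ℝ)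
    (hJ₀ : J₀ ≤ Vmax - Δ * (1 - π₀ a₀))
    (hJ₁ : J₁ ≤ Vmax - Δ * (1 - π₁ a₁)) :
    min J₀ J₁ ≤ Vmax - Δ / 2 := by
  classical
  subst heq
  have hpair : π₀ a₀ + π₀ a₁ ≤ 1 := by
    rw [← sum_pair hne, ← hπ₀_sum]
    exact sum_le_sum_of_subset_of_nonneg (subset_univ _) fun a _ _ => hπ₀_nonneg a
  have hscaled : Δ * (π₀ a₀ + π₀ a₁) ≤ Δ := mul_le_of_le_one_right hΔ.le hpair
  linarith [min_le_left J₀ J₁, min_le_right J₀ J₁]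
end

section
/- Let n : ℕ, let θ ∈ EuclideanSpace ℝ (Fin n), and let J₀, J₁, d : EuclideanSpace ℝ (Fin n) → ℝ be differentiable at θ with gradient d θ ≠ 0. Set v = −(gradient d θ) / ‖gradient d θ‖ and J = fun x => (1−δ)·J₀ x + δ·J₁ x. Suppose k > 0, L ≥ 0, δ ∈ (0, 1/2), ⟪gradient J₀ θ, v⟫ ≥ k, ‖gradient J₁ θ‖ ≤ L, and δ < k/(k+L). Then ⟪gradient J θ, gradient d θ⟫ < 0; in particular the directional derivative of d along the gradient-ascent direction of J at θ is strictly negative. -/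
open RealInnerProductSpace

/-- The gradient of a linear combination of real-valued functions. -/
theorem gradient_const_mul_add_const_mul {F : Type*} [NormedAddCommGroup F]
    [InnerProductSpace ℝ F] [CompleteSpace F] {f g : F → ℝ} {x : F}
    (hf : DifferentiableAt ℝ f x) (hg : DifferentiableAt ℝ g x) (a b : ℝ) :
    gradient (fun y => a * f y + b * g y) x = a • gradient f x + b • gradient g x := by
  apply HasGradientAt.gradient
  rw [hasGradientAt_iff_hasFDerivAt]
  simpa [toDual_gradient] using
    (hf.hasFDerivAt.const_mul a).fun_add (hg.hasFDerivAt.const_mul b)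

/-- The 'local decrease of d under gradient ascent' conclusion of Theorem 1:
under the alignment and boundedness hypotheses with prior skew δ < k/(k+L), the
mixture gradient is negatively aligned with the gradient of the behavioural
distance, and in particular the directional derivative of d along the
gradient-ascent direction of J at θ is strictly negative. -/
theorem gradient_ascent_decreases_behavioural_distance
    {n : ℕ} (θ : EuclideanSpace ℝ (Fin n))
    (J₀ J₁ d : EuclideanSpace ℝ (Fin n) → ℝ)
    (hJ₀ : DifferentiableAt ℝ J₀ θ)
    (hJ₁ : DifferentiableAt ℝ J₁ θ)
    (hd : DifferentiableAt ℝ d θ)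
    (hgrad : gradient d θ ≠ 0)
    (k L δ : ℝ) (hk : 0 < k) (hL : 0 ≤ L)
    (hδ : δ ∈ Set.Ioo (0 : ℝ) (1/2)) (hδcrit : δ < k / (k + L))
    (v : EuclideanSpace ℝ (Fin n))
    (hv : v = -(‖gradient d θ‖)⁻¹ • gradient d θ)
    (halign : ⟪gradient J₀ θ, v⟫ ≥ k)
    (hbound : ‖gradient J₁ θ‖ ≤ L)
    (J : EuclideanSpace ℝ (Fin n) → ℝ)
    (hJ : J = fun x => (1 - δ) * J₀ x + δ * J₁ x) :
    ⟪gradient J θ, gradient d θ⟫ < 0 ∧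
      fderiv ℝ d θ (gradient J θ) < 0 := by
  have key : ⟪gradient J θ, gradient d θ⟫ < 0 := by
    have hg : 0 < ‖gradient d θ‖ := norm_pos_iff.mpr hgrad
    have h₀ : ⟪gradient J₀ θ, gradient d θ⟫ ≤ -(k * ‖gradient d θ‖) := by
      rw [hv, inner_smul_right, ge_iff_le, neg_mul, inv_mul_eq_div, ← neg_div,
        le_div_iff₀ hg] at halign
      linarith
    have h₁ : ⟪gradient J₁ θ, gradient d θ⟫ ≤ L * ‖gradient d θ‖ :=
      (real_inner_le_norm _ _).trans (by gcongr)
    have hmix : δ * L - (1 - δ) * k < 0 := by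
      rw [lt_div_iff₀ (by positivity)] at hδcrit
      linarith
    rw [hJ, gradient_const_mul_add_const_mul hJ₀ hJ₁, inner_add_left,
      real_inner_smul_left, real_inner_smul_left]
    calc
      _ ≤ (1 - δ) * -(k * ‖gradient d θ‖) + δ * (L * ‖gradient d θ‖) :=
        add_le_add (mul_le_mul_of_nonneg_left h₀ (by linarith [hδ.2]))
          (mul_le_mul_of_nonneg_left h₁ hδ.1.le)
      _ = (δ * L - (1 - δ) * k) * ‖gradient d θ‖ := by ring
      _ < 0 := mul_neg_of_neg_of_pos hmix hg
  exact ⟨key, by rwa [← inner_gradient_left, real_inner_comm]⟩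
end
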